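/- Let m be a positive integer and let α and θ be real numbers. If x_1,…,x_m and x'_1,…,x'_m are two canonical vertex-selection sequences of length m that have the same number v of distinct values and whose final multiplicity lists (d_1,…,d_v) and (d'_1,…,d'_v) are equal as multisets, then the products of their Hollywood numerators agree: ∏_{j=1}^m w_j = ∏_{j=1}^m w'_j. (This is the combinatorial content of edge exchangeability of the Hollywood model: the probability of a sequence of interactions depends only on the number of vertices and the multiset of vertex degrees.) -/

import Mathlib

/-- `Vmax x j` is `V_j = max_{l < j} x_l` (over indices `1 ≤ l < j`), with `V_1 = 0`. -/
def Vmax (x : ℕ → ℕ) (j : ℕ) : ℕ := (Finset.Ico 1 j).sup x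

/-- `Dcount x j i = #{l < j : x_l = i}` (over indices `1 ≤ l < j`). -/
def Dcount (x : ℕ → ℕ) (j i : ℕ) : ℕ := ((Finset.Ico 1 j).filter (fun l => x l = i)).card

/-- A canonical vertex-selection sequence of length `m`: a sequence of positive integers
with `x 1 = 1` and `x j ≤ 1 + max_{l<j} x l` for all `2 ≤ j ≤ m`. -/
def IsCanonical (m : ℕ) (x : ℕ → ℕ) : Prop :=
  x 1 = 1 ∧ (∀ j ∈ Finset.Icc 1 m, 1 ≤ x j) ∧
    ∀ j ∈ Finset.Icc 2 m, x j ≤ 1 + Vmax x j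

/-- `v`, the number of distinct values of the sequence, which equals `max_{j ≤ m} x j`. -/
def numVertices (m : ℕ) (x : ℕ → ℕ) : ℕ := (Finset.Icc 1 m).sup x

/-- `d i = #{j ≤ m : x_j = i}`, the final multiplicity of the value `i`. -/
def finalMult (m : ℕ) (x : ℕ → ℕ) (i : ℕ) : ℕ :=
  ((Finset.Icc 1 m).filter (fun j => x j = i)).card

/-- The Hollywood numerator at step `j`:
`w j = D_j(x_j) − α` if `x_j ≤ V_j`, and `w j = θ + α·V_j` if `x_j = V_j + 1`. -/
noncomputable def hollywoodNumerator (x : ℕ → ℕ) (α θ : ℝ) (j : ℕ) : ℝ :=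
  if x j ≤ Vmax x j then (Dcount x j (x j) : ℝ) - α else θ + α * (Vmax x j : ℝ)

theorem Vmax_succ (x : ℕ → ℕ) (n : ℕ) : Vmax x (n + 1) = numVertices n x := by
  rfl

theorem Dcount_succ (x : ℕ → ℕ) (n i : ℕ) : Dcount x (n + 1) i = finalMult n x i := by
  rfl

theorem numVertices_succ (n : ℕ) (x : ℕ → ℕ) :
    numVertices (n + 1) x = max (numVertices n x) (x (n + 1)) := by
  rw [numVertices, ← Finset.insert_Icc_right_eq_Icc_add_one (by omega), Finset.sup_insert,
    sup_comm]
  rfl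

theorem finalMult_succ (n : ℕ) (x : ℕ → ℕ) (i : ℕ) :
    finalMult (n + 1) x i = finalMult n x i + if x (n + 1) = i then 1 else 0 := by
  simp only [finalMult, Finset.card_filter]
  exact Finset.sum_Icc_succ_top (by omega) _

theorem finalMult_eq_zero {n : ℕ} {x : ℕ → ℕ} {i : ℕ} (h : numVertices n x < i) :
    finalMult n x i = 0 := by
  rw [finalMult, Finset.card_eq_zero, Finset.filter_eq_empty_iff]
  intro j hj hji
  have : x j ≤ numVertices n x := Finset.le_sup hj
  omega

theorem IsCanonical.le_numVertices_add_one {m : ℕ} {x : ℕ → ℕ} (hx : IsCanonical m x) {n : ℕ}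
    (hn : n + 1 ≤ m) : x (n + 1) ≤ numVertices n x + 1 := by
  rcases Nat.eq_zero_or_pos n with rfl | h
  · simp [hx.1]
  · have := hx.2.2 (n + 1) (Finset.mem_Icc.2 ⟨by omega, hn⟩)
    rw [Vmax_succ] at this
    omega

/-- Every value up to the maximum of a canonical sequence occurs. -/
theorem IsCanonical.finalMult_pos {m : ℕ} {x : ℕ → ℕ} (hx : IsCanonical m x) {n : ℕ}
    (hn : n ≤ m) {i : ℕ} (hi : 1 ≤ i) (hiv : i ≤ numVertices n x) : 0 < finalMult n x i := by
  induction n with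
  | zero =>
    simp [numVertices] at hiv
    omega
  | succ n ih =>
    have hle := hx.le_numVertices_add_one hn
    rw [numVertices_succ] at hiv
    rw [finalMult_succ]
    by_cases h : i ≤ numVertices n x
    · have := ih (by omega) h
      omega
    · rw [if_pos (by omega)]
      omega

/-- The product of the Hollywood numerators in terms of the number of vertices and the final
multiplicities. -/
theorem IsCanonical.prod_hollywoodNumerator {m : ℕ} {x : ℕ → ℕ} (hx : IsCanonical m x)
    (α θ : ℝ) {n : ℕ} (hn : n ≤ m) :
    ∏ j ∈ Finset.Icc 1 n, hollywoodNumerator x α θ j =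
      (∏ k ∈ Finset.range (numVertices n x), (θ + α * (k : ℝ))) *
        ∏ i ∈ Finset.Icc 1 (numVertices n x),
          ∏ r ∈ Finset.Ico 1 (finalMult n x i), ((r : ℝ) - α) := by
  induction n with
  | zero => simp [numVertices]
  | succ n ih =>
    have hle := hx.le_numVertices_add_one hn
    have hpos : 1 ≤ x (n + 1) := hx.2.1 (n + 1) (Finset.mem_Icc.2 ⟨by omega, hn⟩)
    rw [Finset.prod_Icc_succ_top (by omega), ih (by omega), hollywoodNumerator, Vmax_succ,
      Dcount_succ, numVertices_succ]
    by_cases h : x (n + 1) ≤ numVertices n x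
    · rw [if_pos h, max_eq_left h]
      have hmem : x (n + 1) ∈ Finset.Icc 1 (numVertices n x) := Finset.mem_Icc.2 ⟨hpos, h⟩
      have hd : 1 ≤ finalMult n x (x (n + 1)) := hx.finalMult_pos (by omega) hpos h
      rw [← Finset.mul_prod_erase _ _ hmem, ← Finset.mul_prod_erase _ _ hmem,
        finalMult_succ n x (x (n + 1)), if_pos rfl, Finset.prod_Ico_succ_top hd]
      have herase : ∀ i ∈ (Finset.Icc 1 (numVertices n x)).erase (x (n + 1)),
          ∏ r ∈ Finset.Ico 1 (finalMult (n + 1) x i), ((r : ℝ) - α) =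
            ∏ r ∈ Finset.Ico 1 (finalMult n x i), ((r : ℝ) - α) := by
        intro i hi
        rw [finalMult_succ, if_neg (Finset.ne_of_mem_erase hi).symm, add_zero]
      rw [Finset.prod_congr rfl herase]
      ring
    · have hxv : x (n + 1) = numVertices n x + 1 := by omega
      have hold : ∀ i ∈ Finset.Icc 1 (numVertices n x),
          ∏ r ∈ Finset.Ico 1 (finalMult (n + 1) x i), ((r : ℝ) - α) =
            ∏ r ∈ Finset.Ico 1 (finalMult n x i), ((r : ℝ) - α) := by
        intro i hi
        have := (Finset.mem_Icc.1 hi).2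
        rw [finalMult_succ, if_neg (by omega), add_zero]
      have hnew : finalMult (n + 1) x (numVertices n x + 1) = 1 := by
        rw [finalMult_succ, if_pos hxv, finalMult_eq_zero (Nat.lt_succ_self _)]
      rw [if_neg h, hxv, max_eq_right (Nat.le_succ _), Finset.prod_range_succ,
        Finset.prod_Icc_succ_top (by omega), Finset.prod_congr rfl hold, hnew]
      simp only [Finset.Ico_self, Finset.prod_empty]
      ring

/-- Edge exchangeability of the Hollywood model (combinatorial content): if two canonical
vertex-selection sequences of length `m` have the same number `v` of distinct values and the
same multiset of final multiplicities `(d_1, …, d_v)`, then the products of their Hollywood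
numerators agree. -/
theorem hollywood_numerator_product_exchangeable (m : ℕ) (hm : 0 < m) (α θ : ℝ)
    (x x' : ℕ → ℕ) (hx : IsCanonical m x) (hx' : IsCanonical m x')
    (hv : numVertices m x = numVertices m x')
    (hd : Multiset.map (finalMult m x) (Finset.Icc 1 (numVertices m x)).val =
      Multiset.map (finalMult m x') (Finset.Icc 1 (numVertices m x)).val) :
    ∏ j ∈ Finset.Icc 1 m, hollywoodNumerator x α θ j =
      ∏ j ∈ Finset.Icc 1 m, hollywoodNumerator x' α θ j := by
  rw [hx.prod_hollywoodNumerator α θ le_rfl, hx'.prod_hollywoodNumerator α θ le_rfl, ← hv]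
  congr 1
  have := congrArg
    (fun s : Multiset ℕ => (s.map fun d : ℕ => ∏ r ∈ Finset.Ico 1 d, ((r : ℝ) - α)).prod) hd
  simp only [Multiset.map_map, Function.comp_def] at this
  exact this
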